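/- Let α ≥ 2 be a countable ordinal. If L ⊆ Σ^ω is a Π⁰_α-subset (respectively, Σ⁰_α-subset) of Σ^ω, then h(L) is a Π⁰_α-subset (respectively, Σ⁰_α-subset) of Γ^ω. -/

import Mathlib

universe u

/-- We equip `Option σ` (the alphabet `Γ = Σ ∪ {A}`, with `A = none`) with the
discrete topology. -/
instance instTopOption (σ : Type u) : TopologicalSpace (Option σ) := ⊥
instance instDiscreteOption (σ : Type u) : DiscreteTopology (Option σ) := ⟨rfl⟩

/-- Auxiliary function for the coding map `h`: reads position `i` inside the
concatenation of the blocks `A·0^(n+1)·x(n), A·0^(n+2)·x(n+1), ...`. -/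
def hAux {σ : Type u} (z : σ) (x : ℕ → σ) : ℕ → ℕ → Option σ
  | _, 0 => none
  | n, (i+1) =>
    if i + 1 ≤ n + 1 then some z
    else if i + 1 = n + 2 then some (x n)
    else hAux z x (n+1) (i + 1 - (n+3))
  termination_by n i => i
  decreasing_by omega

/-- The coding map `h : Σ^ω → Γ^ω`,
`h(x) = A·0·x(1)·A·0²·x(2)·A·0³·x(3)···A·0ⁿ·x(n)···` (ω-words indexed by `ℕ`). -/
def hmap {σ : Type u} (z : σ) (x : ℕ → σ) : ℕ → Option σ := fun i => hAux z x 0 i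

/-- Auxiliary function for the ω-word `α₀`. -/
def aAux {σ : Type u} (z : σ) : ℕ → ℕ → Option σ
  | _, 0 => none
  | n, (i+1) =>
    if i + 1 ≤ n + 1 then some z
    else aAux z (n+1) (i + 1 - (n+2))
  termination_by n i => i
  decreasing_by omega

/-- The ω-word `α₀ = A·0·A·0²·A·0³···A·0ⁿ···` over `Γ = Σ ∪ {A}`. -/
def alphaWord {σ : Type u} (z : σ) : ℕ → Option σ := fun i => aAux z 0 i

/-- The Borel hierarchy on a topological space `X`: `SigmaPi X α true` is the class
`Σ⁰_α` and `SigmaPi X α false` is the class `Π⁰_α`.  `Σ⁰_1` is the class of open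
sets, `Π⁰_1` is the class of closed sets, and for `α ≥ 2`, `Σ⁰_α` (resp. `Π⁰_α`)
is the class of countable unions (resp. intersections) of sets in
`⋃_{γ < α} Π⁰_γ` (resp. `⋃_{γ < α} Σ⁰_γ`). -/
def SigmaPi (X : Type u) [TopologicalSpace X] (α : Ordinal.{0}) (b : Bool) : Set (Set X) :=
  {s | (α = 1 ∧ ((b = true ∧ IsOpen s) ∨ (b = false ∧ IsClosed s)))
    ∨ (α ≠ 1 ∧ ∃ f : ℕ → Set X,
        (∀ n : ℕ, ∃ γ : Ordinal.{0}, ∃ _ : γ < α, f n ∈ SigmaPi X γ !b) ∧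
        s = if b then ⋃ n, f n else ⋂ n, f n)}
  termination_by α
  decreasing_by assumption

/-- The class `Σ⁰_α` of the Borel hierarchy on `X`. -/
abbrev Sigma0 (X : Type u) [TopologicalSpace X] (α : Ordinal.{0}) : Set (Set X) :=
  SigmaPi X α true

/-- The class `Π⁰_α` of the Borel hierarchy on `X`. -/
abbrev Pi0 (X : Type u) [TopologicalSpace X] (α : Ordinal.{0}) : Set (Set X) :=
  SigmaPi X α false

/-- `F ⊆ Σ^ω` is `Σ⁰_α`-complete (for `b = true`), resp. `Π⁰_α`-complete (for
`b = false`), iff for every nonempty finite alphabet `Y` and every `E ⊆ Y^ω`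
(with `Y^ω` carrying the Cantor topology, i.e. the product of the discrete
topology): `E ∈ Σ⁰_α` (resp. `Π⁰_α`) iff `E = f⁻¹(F)` for some continuous
`f : Y^ω → Σ^ω`. -/
def IsCompleteFor (b : Bool) (α : Ordinal.{0}) {σ : Type} [TopologicalSpace σ]
    (F : Set (ℕ → σ)) : Prop :=
  ∀ (Y : Type), Fintype Y → Nonempty Y → ∀ E : Set (ℕ → Y),
    letI : TopologicalSpace Y := ⊥
    (E ∈ SigmaPi (ℕ → Y) α b ↔
      ∃ f : (ℕ → Y) → (ℕ → σ), Continuous f ∧ E = f ⁻¹' F)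

/-- The infinite concatenation of the finite words `u 0, u 1, u 2, ...` equals the
ω-word `x`: every finite partial concatenation is a prefix of `x`, and the total
length is infinite. -/
def JoinsTo {α : Type u} (u : ℕ → List α) (x : ℕ → α) : Prop :=
  (∀ N : ℕ, ∃ n : ℕ, N ≤ (((List.range n).map u).flatten).length) ∧
  (∀ (n i : ℕ) (h : i < (((List.range n).map u).flatten).length),
      (((List.range n).map u).flatten)[i]'h = x i)

/-- A 2-tape Büchi automaton with input alphabet `σ` and output alphabet `γ`:
a finite set of states `Q`, a finite set `trans ⊆ Q × σ^⋆ × γ^⋆ × Q` of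
transitions, an initial state `init` and a set `acc` of accepting states. -/
structure TwoTapeBuchi (σ γ : Type u) where
  Q : Type u
  finQ : Finite Q
  trans : Set (Q × List σ × List γ × Q)
  finTrans : trans.Finite
  init : Q
  acc : Set Q

/-- The pair `(x, y)` of ω-words is accepted by the 2-tape Büchi automaton `T`
iff it is the pair of input and output words of some successful computation. -/
def TwoTapeBuchi.Accepts {σ γ : Type u} (T : TwoTapeBuchi σ γ)
    (x : ℕ → σ) (y : ℕ → γ) : Prop :=
  ∃ (q : ℕ → T.Q) (u : ℕ → List σ) (v : ℕ → List γ),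
    q 0 = T.init ∧
    (∀ n : ℕ, (q n, u n, v n, q (n+1)) ∈ T.trans) ∧
    (∃ qf ∈ T.acc, ∀ n : ℕ, ∃ m : ℕ, n ≤ m ∧ q m = qf) ∧
    JoinsTo u x ∧ JoinsTo v y

/-- `R ⊆ Σ^ω × Γ^ω` is an infinitary rational relation iff it is the relation
accepted by some 2-tape Büchi automaton. -/
def IsRatRel {σ γ : Type u} (R : Set ((ℕ → σ) × (ℕ → γ))) : Prop :=
  ∃ T : TwoTapeBuchi σ γ, ∀ p : (ℕ → σ) × (ℕ → γ), p ∈ R ↔ T.Accepts p.1 p.2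

/-- A real-time Büchi 1-counter automaton: transitions are in
`Q × σ × Bool × Q × ℤ` with the counter move in `{-1, 0, 1}`, and a zero test
(`false` means the counter is zero) which forbids decrementing a zero counter. -/
structure OneCounterBuchi (σ : Type u) where
  Q : Type u
  finQ : Finite Q
  trans : Set (Q × σ × Bool × Q × ℤ)
  transMoves : ∀ t ∈ trans, t.2.2.2.2 = -1 ∨ t.2.2.2.2 = 0 ∨ t.2.2.2.2 = 1
  transZero : ∀ t ∈ trans, t.2.2.1 = false → t.2.2.2.2 = 0 ∨ t.2.2.2.2 = 1
  init : Q
  acc : Set Q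

/-- One computation step of a 1-counter automaton on letter `a`, from
configuration `p` to configuration `p'`. -/
def OneCounterBuchi.Step {σ : Type u} (M : OneCounterBuchi σ) (a : σ)
    (p p' : M.Q × ℕ) : Prop :=
  ∃ j : ℤ, (p.1, a, (p.2 ≠ 0 : Bool), p'.1, j) ∈ M.trans ∧ (p'.2 : ℤ) = (p.2 : ℤ) + j

/-- The ω-word `x` is accepted by the real-time Büchi 1-counter automaton `M`:
there is a run on `x` starting in `(q₀, 0)` in which some accepting state occurs
infinitely often. -/
def OneCounterBuchi.Accepts {σ : Type u} (M : OneCounterBuchi σ) (x : ℕ → σ) : Prop :=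
  ∃ r : ℕ → M.Q × ℕ,
    r 0 = (M.init, 0) ∧
    (∀ i : ℕ, M.Step (x i) (r i) (r (i+1))) ∧
    ∃ qf ∈ M.acc, ∀ n : ℕ, ∃ m : ℕ, n ≤ m ∧ (r m).1 = qf

/-- The identification of a pair of ω-words with an ω-word over the product
alphabet. -/
def pairToWord {a b : Type u} (p : (ℕ → a) × (ℕ → b)) : ℕ → a × b :=
  fun n => (p.1 n, p.2 n)

theorem sp_true {X : Type} [TopologicalSpace X] {α : Ordinal.{0}} (h : α ≠ 1) (s : Set X) :
    s ∈ SigmaPi X α true ↔ ∃ f : ℕ → Set X,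
      (∀ n, ∃ γ : Ordinal.{0}, γ < α ∧ f n ∈ SigmaPi X γ false) ∧ s = ⋃ n, f n := by
  rw [SigmaPi]; simp [h]

theorem sp_false {X : Type} [TopologicalSpace X] {α : Ordinal.{0}} (h : α ≠ 1) (s : Set X) :
    s ∈ SigmaPi X α false ↔ ∃ f : ℕ → Set X,
      (∀ n, ∃ γ : Ordinal.{0}, γ < α ∧ f n ∈ SigmaPi X γ true) ∧ s = ⋂ n, f n := by
  rw [SigmaPi]; simp [h]

theorem sp_one_true {X : Type} [TopologicalSpace X] (s : Set X) :
    s ∈ SigmaPi X 1 true ↔ IsOpen s := by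
  rw [SigmaPi]; simp

theorem sp_one_false {X : Type} [TopologicalSpace X] (s : Set X) :
    s ∈ SigmaPi X 1 false ↔ IsClosed s := by
  rw [SigmaPi]; simp

theorem sp_zero {X : Type} [TopologicalSpace X] (b : Bool) (s : Set X) :
    s ∉ SigmaPi X 0 b := by
  rw [SigmaPi]; simp

theorem sp_preimage {X Y : Type} [TopologicalSpace X] [TopologicalSpace Y] (g : X → Y)
    (hg : Continuous g) (α : Ordinal.{0}) : ∀ (b : Bool) (s : Set Y),
    s ∈ SigmaPi Y α b → g ⁻¹' s ∈ SigmaPi X α b := by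
  induction α using WellFoundedLT.induction with
  | ind α ih =>
  intro b s hs
  by_cases h1 : α = 1
  · subst h1
    cases b
    · rw [sp_one_false] at *; exact hs.preimage hg
    · rw [sp_one_true] at *; exact hs.preimage hg
  · cases b
    · rw [sp_false h1] at *
      obtain ⟨f, hf, rfl⟩ := hs
      refine ⟨fun n => g ⁻¹' f n, fun n => ?_, Set.preimage_iInter⟩
      obtain ⟨γ, hγ, h⟩ := hf n
      exact ⟨γ, hγ, ih γ hγ _ _ h⟩
    · rw [sp_true h1] at *
      obtain ⟨f, hf, rfl⟩ := hs
      refine ⟨fun n => g ⁻¹' f n, fun n => ?_, Set.preimage_iUnion⟩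
      obtain ⟨γ, hγ, h⟩ := hf n
      exact ⟨γ, hγ, ih γ hγ _ _ h⟩

theorem sp_inter_false {X : Type} [TopologicalSpace X] (U : ℕ → Set X)
    (ho : ∀ n, IsOpen (U n)) (α : Ordinal.{0}) (h2 : 1 < α) (s : Set X)
    (hs : s ∈ SigmaPi X α false) : s ∩ ⋂ n, U n ∈ SigmaPi X α false := by
  rw [sp_false h2.ne'] at *
  obtain ⟨f, hf, rfl⟩ := hs
  refine ⟨fun k => if k % 2 = 0 then f (k / 2) else U (k / 2), fun k => ?_, ?_⟩
  · dsimp only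
    split_ifs
    · exact hf _
    · exact ⟨1, h2, (sp_one_true _).2 (ho _)⟩
  · ext x
    simp only [Set.mem_inter_iff, Set.mem_iInter]
    constructor
    · rintro ⟨ha, hb⟩ k
      split_ifs
      · exact ha _
      · exact hb _
    · intro h
      refine ⟨fun n => ?_, fun n => ?_⟩
      · have := h (2 * n)
        rwa [if_pos (by omega), show 2 * n / 2 = n by omega] at this
      · have := h (2 * n + 1)
        rwa [if_neg (by omega), show (2 * n + 1) / 2 = n by omega] at this

theorem sp_inter {X : Type} [TopologicalSpace X] (U : ℕ → Set X)
    (ho : ∀ n, IsOpen (U n)) (hc : ∀ n, IsClosed (U n)) (α : Ordinal.{0}) (h2 : 1 < α)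
    (b : Bool) (s : Set X)
    (hs : s ∈ SigmaPi X α b) : s ∩ ⋂ n, U n ∈ SigmaPi X α b := by
  cases b
  · exact sp_inter_false U ho α h2 s hs
  · rw [sp_true h2.ne'] at *
    obtain ⟨f, hf, rfl⟩ := hs
    refine ⟨fun n => f n ∩ ⋂ n, U n, fun n => ?_, Set.iUnion_inter _ _⟩
    obtain ⟨γ, hγ, h⟩ := hf n
    refine ⟨γ, hγ, ?_⟩
    rcases lt_trichotomy γ 1 with h1 | h1 | h1
    · rw [Ordinal.lt_one_iff_zero] at h1
      subst h1
      exact absurd h (sp_zero _ _)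
    · subst h1
      rw [sp_one_false] at *
      exact h.inter (isClosed_iInter hc)
    · exact sp_inter_false U ho γ h1 _ h

theorem hAux_continuous {σ : Type} [TopologicalSpace σ] [DiscreteTopology σ] (z : σ) (i : ℕ) :
    ∀ n, Continuous (fun x : ℕ → σ => hAux z x n i) := by
  induction i using Nat.strong_induction_on with
  | _ i ih =>
  intro n
  cases i with
  | zero => simp only [hAux]; exact continuous_const
  | succ i =>
    by_cases h1 : i + 1 ≤ n + 1
    · simp only [hAux, if_pos h1]; exact continuous_const
    · by_cases h2 : i + 1 = n + 2
      · simp only [hAux, if_neg h1, if_pos h2]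
        exact (continuous_of_discreteTopology (f := (some : σ → Option σ))).comp
          (continuous_apply n)
      · have h := ih (i + 1 - (n + 3)) (by omega) (n + 1)
        have e : (fun x : ℕ → σ => hAux z x n (i + 1)) =
            fun x => hAux z x (n + 1) (i + 1 - (n + 3)) := by
          funext x
          rw [hAux, if_neg h1, if_neg h2]
        rw [e]; exact h

theorem hAux_pos {σ : Type} (z : σ) (n : ℕ) :
    ∀ m, ∃ p, ∀ x : ℕ → σ, hAux z x m p = some (x (m + n)) := by
  induction n with
  | zero =>
    intro m
    refine ⟨m + 1 + 1, fun x => ?_⟩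
    rw [hAux, if_neg (by omega), if_pos (by omega)]; rfl
  | succ n ih =>
    intro m
    obtain ⟨p, hp⟩ := ih (m + 1)
    refine ⟨p + m + 2 + 1, fun x => ?_⟩
    rw [hAux, if_neg (by omega), if_neg (by omega),
      show p + m + 2 + 1 - (m + 3) = p by omega, hp]
    congr 2; omega

/-- For a countable ordinal `α ≥ 2`, if `L ⊆ Σ^ω` is a `Π⁰_α`-
(resp. `Σ⁰_α`-) subset of `Σ^ω` then `h(L)` is a `Π⁰_α`- (resp. `Σ⁰_α`-) subset
of `Γ^ω` (the boolean `b` selects the class: `true` for `Σ⁰_α`, `false` for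
`Π⁰_α`). -/
theorem hmap_image_sigmaPi (σ : Type) [Fintype σ] [Nonempty σ]
    [TopologicalSpace σ] [DiscreteTopology σ] (z : σ)
    (α : Ordinal.{0}) (hα : 2 ≤ α) (hcount : α.card ≤ Cardinal.aleph0)
    (b : Bool) (L : Set (ℕ → σ)) (hL : L ∈ SigmaPi (ℕ → σ) α b) :
    hmap z '' L ∈ SigmaPi (ℕ → Option σ) α b := by
  choose p hp using fun n => hAux_pos z n 0
  let g : (ℕ → Option σ) → (ℕ → σ) := fun y n => (y (p n)).getD z
  have hg : Continuous g := continuous_pi fun n =>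
    (continuous_of_discreteTopology (f := fun o : Option σ => o.getD z)).comp
      (continuous_apply (p n))
  have hgh : ∀ x, g (hmap z x) = x := by
    intro x
    funext n
    simp [g, hmap, hp]
  have hcl : ∀ n, IsClopen {y : ℕ → Option σ | y n = hmap z (g y) n} := by
    intro n
    have hk : Continuous fun y : ℕ → Option σ => (y n, hmap z (g y) n) :=
      (continuous_apply n).prodMk ((hAux_continuous z n 0).comp hg)
    exact (isClopen_discrete {q : Option σ × Option σ | q.1 = q.2}).preimage hk
  have h2 : (1 : Ordinal.{0}) < α := lt_of_lt_of_le (by norm_num) hα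
  have key := sp_inter _ (fun n => (hcl n).2) (fun n => (hcl n).1) α h2 b _
    (sp_preimage g hg α b L hL)
  convert key using 1
  ext y
  simp only [Set.mem_image, Set.mem_inter_iff, Set.mem_preimage, Set.mem_iInter,
    Set.mem_setOf_eq]
  constructor
  · rintro ⟨x, hx, rfl⟩
    rw [hgh]
    exact ⟨hx, fun _ => rfl⟩
  · rintro ⟨h, h'⟩
    exact ⟨g y, h, (funext h').symm⟩
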